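/- Modulus of continuity of the solution of a rough differential equation inherited from the driver (deterministic content of Lemma 4.3): Let 1/3 < γ < H ≤ 1 with H < 2γ, T > 0, and let (x, X²) be a γ-rough path over [0,T] with values in ℝ^m. Assume there are K ≥ 0 and h* ∈ (0, min(T, e^{−1})] such that |x_t − x_s| ≤ K (t−s)^H √(log(1/(t−s))) whenever 0 < t−s ≤ h*. Let σ ∈ C³(ℝ^d; ℝ^{d×m}) be bounded with bounded derivatives up to order three, a ∈ ℝ^d, and let y be the unique solution with exponent 3κ of dy = σ(y)dx, y_0 = a, for some κ ∈ (max(1/3, H/2), γ). Then there exist h** ∈ (0, h*] and a finite constant K', depending only on H, γ, κ, σ, T, K, ‖x‖_{γ,∞,T} and ‖X²‖_{2γ}, such that |y_t − y_s| ≤ K' (t−s)^H √(log(1/(t−s))) whenever 0 < t−s ≤ h**, where ‖x‖_{γ,∞,T} = sup_{t∈[0,T]} |x_t| + sup_{s≠t} |x_t − x_s|/|t−s|^γ. -/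

import Mathlib

open Set
open scoped ENNReal

noncomputable section

/-- `ℝ^m` with the Euclidean norm. -/
abbrev Vec (m : ℕ) := EuclideanSpace ℝ (Fin m)

/-- `ℝ^{m×m}` with the Euclidean norm. -/
abbrev Mat (m : ℕ) := EuclideanSpace ℝ (Fin m × Fin m)

/-- Sup "norm" `sup_{t ∈ [a,b]} ‖f t‖` as an extended nonnegative real. -/
noncomputable def supENorm {E : Type*} [NormedAddCommGroup E] (a b : ℝ) (f : ℝ → E) : ℝ≥0∞ :=
  ⨆ t : Icc a b, ENNReal.ofReal ‖f t‖

/-- γ-Hölder seminorm `sup_{a ≤ s < t ≤ b} ‖f t - f s‖/(t-s)^γ` as an extended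
nonnegative real. -/
noncomputable def holderENorm {E : Type*} [NormedAddCommGroup E] (γ a b : ℝ) (f : ℝ → E) :
    ℝ≥0∞ :=
  ⨆ p : {p : ℝ × ℝ // a ≤ p.1 ∧ p.1 < p.2 ∧ p.2 ≤ b},
    ENNReal.ofReal (‖f p.1.2 - f p.1.1‖ / (p.1.2 - p.1.1) ^ γ)

/-- Hölder seminorm `sup_{a ≤ s < t ≤ b} ‖X_{st}‖/(t-s)^β` of a two-parameter function,
as an extended nonnegative real. -/
noncomputable def holder2ENorm {E : Type*} [NormedAddCommGroup E] (β a b : ℝ)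
    (X : ℝ → ℝ → E) : ℝ≥0∞ :=
  ⨆ p : {p : ℝ × ℝ // a ≤ p.1 ∧ p.1 < p.2 ∧ p.2 ≤ b},
    ENNReal.ofReal (‖X p.1.1 p.1.2‖ / (p.1.2 - p.1.1) ^ β)

/-- The real-valued γ-Hölder norm `‖f‖_{γ,∞} = sup ‖f‖ + Hölder seminorm` on `[a,b]`. -/
noncomputable def holderInftyNorm {E : Type*} [NormedAddCommGroup E] (γ a b : ℝ)
    (f : ℝ → E) : ℝ :=
  (supENorm a b f + holderENorm γ a b f).toReal

/-- A γ-rough path `(x, X²)` over `[a,b]` with values in `ℝ^m`: `x` has finite γ-Hölder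
seminorm, `X²` is continuous on the simplex with finite 2γ-Hölder seminorm and Chen's
relation holds. -/
def IsRoughPath (m : ℕ) (γ a b : ℝ) (x : ℝ → Vec m) (X2 : ℝ → ℝ → Mat m) : Prop :=
  holderENorm γ a b x < ⊤ ∧
  ContinuousOn (fun p : ℝ × ℝ => X2 p.1 p.2)
    {p : ℝ × ℝ | a ≤ p.1 ∧ p.1 ≤ p.2 ∧ p.2 ≤ b} ∧
  holder2ENorm (2 * γ) a b X2 < ⊤ ∧
  ∀ s u t : ℝ, a ≤ s → s ≤ u → u ≤ t → t ≤ b → ∀ i j : Fin m,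
    X2 s t (i, j) - X2 s u (i, j) - X2 u t (i, j) = (x u i - x s i) * (x t j - x u j)

/-- `σ` is `C³`, bounded with bounded derivatives up to order three. -/
def IsC3Bounded {E F : Type*} [NormedAddCommGroup E] [NormedSpace ℝ E]
    [NormedAddCommGroup F] [NormedSpace ℝ F] (σ : E → F) : Prop :=
  ContDiff ℝ 3 σ ∧ ∀ n : ℕ, n ≤ 3 → ∃ B : ℝ, ∀ z : E, ‖iteratedFDeriv ℝ n σ z‖ ≤ B

/-- The vector field `D^{(i)}σ^{(j)} = ∑_l σ^{(i)}_l ∂_l σ^{(j)}`, i.e. the derivative of the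
`j`-th column of `σ` in the direction of the `i`-th column. -/
noncomputable def Dvf (d m : ℕ) (σ : Vec d → Vec m →L[ℝ] Vec d) (i j : Fin m)
    (z : Vec d) : Vec d :=
  fderiv ℝ (fun w => σ w (EuclideanSpace.single j (1 : ℝ))) z
    (σ z (EuclideanSpace.single i (1 : ℝ)))

/-- `y` is a solution, with exponent `θ`, of the rough differential equation `dy = σ(y)dx`,
`y_0 = a`, on `[0,T]` (Davie's formulation). -/
def IsRDESolution (d m : ℕ) (θ T : ℝ) (σ : Vec d → Vec m →L[ℝ] Vec d) (x : ℝ → Vec m)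
    (X2 : ℝ → ℝ → Mat m) (a : Vec d) (y : ℝ → Vec d) : Prop :=
  ContinuousOn y (Icc 0 T) ∧ y 0 = a ∧
  ∃ C : ℝ, ∀ s t : ℝ, 0 ≤ s → s ≤ t → t ≤ T →
    ‖y t - y s - σ (y s) (x t - x s) -
        ∑ i : Fin m, ∑ j : Fin m, X2 s t (i, j) • Dvf d m σ i j (y s)‖
      ≤ C * (t - s) ^ θ


lemma aux_iter (T h θ γ c C : ℝ) (R : ℝ → ℝ → ℝ) (hθ : 1 < θ) (hγ : 0 < γ) (hc : 0 ≤ c)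
    (hC : 0 ≤ C)
    (hch : c * h ^ γ ≤ (1 - 2 * (1/2:ℝ) ^ θ) / 2)
    (h0 : ∀ s t, 0 ≤ s → s < t → t ≤ T → t - s ≤ h → R s t ≤ C * (t - s) ^ θ)
    (h1 : ∀ s t, 0 ≤ s → s < t → t ≤ T → t - s ≤ h →
      R s t ≤ R s ((s + t)/2) + R ((s+t)/2) t + c * (t - s) ^ θ
        + c * (t - s) ^ γ * R s ((s+t)/2)) :
    ∀ s t, 0 ≤ s → s < t → t ≤ T → t - s ≤ h →
      R s t ≤ 2 * c / (1 - 2 * (1/2:ℝ) ^ θ) * (t - s) ^ θ := by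
  set w := 2 * (1/2:ℝ) ^ θ with hw
  have hw1 : w < 1 := by
    have : (1/2:ℝ) ^ θ < (1/2:ℝ) ^ (1:ℝ) :=
      Real.rpow_lt_rpow_of_exponent_gt (by norm_num) (by norm_num) hθ
    rw [Real.rpow_one] at this
    linarith
  have hw0 : 0 < w := by positivity
  have hhalf1 : (1/2:ℝ) ^ θ ≤ 1 := by linarith
  have hne : (1 - w) ≠ 0 := by linarith
  have key : ∀ n : ℕ, ∀ s t, 0 ≤ s → s < t → t ≤ T → t - s ≤ h →
      R s t ≤ (((1 + w)/2) ^ n * C + 2 * c / (1 - w)) * (t - s) ^ θ := by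
    intro n
    induction n with
    | zero =>
      intro s t hs hst ht hh
      refine (h0 s t hs hst ht hh).trans ?_
      have : 0 < t - s := by linarith
      have : 0 ≤ 2 * c / (1 - w) := div_nonneg (by linarith) (by linarith)
      gcongr
      simp; linarith
    | succ n ih =>
      intro s t hs hst ht hh
      have hd : 0 < t - s := by linarith
      set L := ((1 + w)/2) ^ n * C + 2 * c / (1 - w) with hL
      have hL0 : 0 ≤ L := by
        have : 0 ≤ 2 * c / (1 - w) := div_nonneg (by linarith) (by linarith)
        positivity
      have e1 := ih s ((s+t)/2) hs (by linarith) (by linarith) (by linarith)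
      have e2 := ih ((s+t)/2) t (by linarith) (by linarith) ht (by linarith)
      have g1 : (s+t)/2 - s = (t - s) * (1/2) := by ring
      have g2 : t - (s+t)/2 = (t - s) * (1/2) := by ring
      rw [g1, Real.mul_rpow hd.le (by norm_num)] at e1
      rw [g2, Real.mul_rpow hd.le (by norm_num)] at e2
      have e3 := h1 s t hs hst ht hh
      have hDpos : 0 < (t-s)^θ := by positivity
      have hη : c * (t - s) ^ γ ≤ (1 - w)/2 := by
        refine le_trans ?_ hch
        gcongr
      have hη0 : 0 ≤ c * (t - s) ^ γ := by positivity
      have e4 : c * (t - s) ^ γ * R s ((s+t)/2) ≤ (1 - w)/2 * (L * (t - s) ^ θ) := by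
        calc c * (t - s) ^ γ * R s ((s+t)/2) ≤ c * (t - s) ^ γ * (L * (t-s)^θ) := by
              gcongr
              refine e1.trans ?_
              gcongr
              nlinarith
          _ ≤ _ := by gcongr
      have : (((1 + w)/2) ^ (n+1) * C + 2 * c / (1 - w)) = w * L + (1-w)/2 * L + c := by
        rw [hL, pow_succ]; field_simp; ring
      rw [this]
      have hwD : L * ((t-s)^θ * (1/2)^θ) + L * ((t-s)^θ * (1/2)^θ) = w * L * (t-s)^θ := by
        rw [hw]; ring
      nlinarith
  intro s t hs hst ht hh
  have lim : Filter.Tendsto (fun n : ℕ => (((1 + w)/2) ^ n * C + 2 * c / (1 - w)) * (t - s) ^ θ)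
      Filter.atTop (nhds ((0 * C + 2 * c / (1 - w)) * (t - s) ^ θ)) := by
    refine (((tendsto_pow_atTop_nhds_zero_of_lt_one (by linarith) (by linarith)).mul_const _).add_const _).mul_const _
  have := ge_of_tendsto' lim (fun n => key n s t hs hst ht hh)
  simpa using this

lemma aux_sigma {E F : Type*} [NormedAddCommGroup E] [NormedSpace ℝ E]
    [NormedAddCommGroup F] [NormedSpace ℝ F] (σ : E → F) (hσ : IsC3Bounded σ) :
    ∃ B : ℝ, 0 ≤ B ∧ (∀ z, ‖σ z‖ ≤ B) ∧ (∀ z, ‖fderiv ℝ σ z‖ ≤ B) ∧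
      (∀ z w, ‖σ z - σ w‖ ≤ B * ‖z - w‖) ∧
      (∀ z w, ‖fderiv ℝ σ z - fderiv ℝ σ w‖ ≤ B * ‖z - w‖) ∧
      (∀ z b, ‖σ (z + b) - σ z - fderiv ℝ σ z b‖ ≤ B * ‖b‖ ^ 2) := by
  obtain ⟨hc, hb⟩ := hσ
  obtain ⟨B0, h0⟩ := hb 0 (by norm_num)
  obtain ⟨B1, h1⟩ := hb 1 (by norm_num)
  obtain ⟨B2, h2⟩ := hb 2 (by norm_num)
  have hd : Differentiable ℝ σ := hc.differentiable (by norm_num)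
  have hc1 : ContDiff ℝ 1 (fderiv ℝ σ) := hc.fderiv_right (by norm_num)
  have hd1 : Differentiable ℝ (fderiv ℝ σ) := hc1.differentiable (by norm_num)
  set B := max (max B0 B1) (max B2 0) with hB
  have k0 : ∀ z, ‖σ z‖ ≤ B := fun z => by
    have := h0 z
    rw [norm_iteratedFDeriv_zero] at this
    exact this.trans (by simp [hB])
  have k1 : ∀ z, ‖fderiv ℝ σ z‖ ≤ B := fun z => by
    have := h1 z
    rw [norm_iteratedFDeriv_one] at this
    exact this.trans (by simp [hB])
  have k2 : ∀ z, ‖fderiv ℝ (fderiv ℝ σ) z‖ ≤ B := fun z => by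
    have := h2 z
    rw [← norm_iteratedFDeriv_fderiv, norm_iteratedFDeriv_one] at this
    exact this.trans (by simp [hB])
  have k3 : ∀ z w, ‖fderiv ℝ σ z - fderiv ℝ σ w‖ ≤ B * ‖z - w‖ := fun z w =>
    convex_univ.norm_image_sub_le_of_norm_fderiv_le (fun x _ => hd1 x) (fun x _ => k2 x)
      (mem_univ w) (mem_univ z)
  refine ⟨B, by simp [hB], k0, k1, ?_, k3, ?_⟩
  · exact fun z w => convex_univ.norm_image_sub_le_of_norm_fderiv_le (fun x _ => hd x)
      (fun x _ => k1 x) (mem_univ w) (mem_univ z)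
  · intro z b
    have := (convex_segment z (z+b)).norm_image_sub_le_of_norm_fderiv_le' (f := σ) (𝕜 := ℝ)
      (φ := fderiv ℝ σ z) (C := B * ‖b‖) (x := z) (y := z + b) (fun x _ => hd x) ?_
      (left_mem_segment ℝ _ _) (right_mem_segment ℝ _ _)
    · simp only [add_sub_cancel_left] at this
      rw [pow_two, ← mul_assoc]; exact this
    · intro x hx
      refine (k3 x z).trans ?_
      have hB0 : 0 ≤ B := by simp [hB]
      gcongr
      rw [segment_eq_image'] at hx
      obtain ⟨r, hr, rfl⟩ := hx
      simp only [add_sub_cancel_left, norm_smul, Real.norm_eq_abs]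
      rw [abs_of_nonneg hr.1]
      exact mul_le_of_le_one_left (norm_nonneg _) hr.2

/-- The second-order term. -/
def GG (d m : ℕ) (σ : Vec d → Vec m →L[ℝ] Vec d) (z : Vec d) (X : Mat m) : Vec d :=
  ∑ i : Fin m, ∑ j : Fin m, X (i, j) • Dvf d m σ i j z

lemma Dvf_eq {d m : ℕ} (σ : Vec d → Vec m →L[ℝ] Vec d) (hd : Differentiable ℝ σ) (i j : Fin m)
    (z : Vec d) : Dvf d m σ i j z = fderiv ℝ σ z (σ z (EuclideanSpace.single i (1:ℝ)))
      (EuclideanSpace.single j (1:ℝ)) := by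
  unfold Dvf
  rw [fderiv_clm_apply (hd z) (differentiableAt_const _)]
  simp

lemma vec_sum {m : ℕ} (a : Vec m) : a = ∑ i, a i • EuclideanSpace.single i (1:ℝ) := by
  ext k
  simp [Finset.sum_apply, Pi.single_apply]

lemma GG_chen {d m : ℕ} (σ : Vec d → Vec m →L[ℝ] Vec d) (hd : Differentiable ℝ σ) (z : Vec d)
    (X Y Z : Mat m) (a b : Vec m) (h : ∀ i j, X (i,j) - Y (i,j) - Z (i,j) = a i * b j) :
    GG d m σ z X - GG d m σ z Y - GG d m σ z Z = fderiv ℝ σ z (σ z a) b := by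
  conv_rhs => rw [vec_sum a, vec_sum b]
  unfold GG
  simp only [← Finset.sum_sub_distrib, ← sub_smul, h, Dvf_eq σ hd, map_sum, map_smul,
    ContinuousLinearMap.sum_apply, ContinuousLinearMap.smul_apply]
  rw [Finset.sum_comm]
  simp only [Finset.smul_sum, smul_smul, mul_comm]

lemma GG_bound {d m : ℕ} (σ : Vec d → Vec m →L[ℝ] Vec d) (hd : Differentiable ℝ σ) (B : ℝ)
    (hB : 0 ≤ B) (k0 : ∀ z, ‖σ z‖ ≤ B) (k1 : ∀ z, ‖fderiv ℝ σ z‖ ≤ B)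
    (z : Vec d) (X : Mat m) : ‖GG d m σ z X‖ ≤ (m:ℝ)^2 * B^2 * ‖X‖ := by
  unfold GG
  have : ∀ i j, ‖X (i,j) • Dvf d m σ i j z‖ ≤ ‖X‖ * B^2 := by
    intro i j
    rw [norm_smul, Dvf_eq σ hd]
    have h1 := PiLp.norm_apply_le X (i,j)
    have h2 : ‖fderiv ℝ σ z (σ z (EuclideanSpace.single i (1:ℝ)))
      (EuclideanSpace.single j (1:ℝ))‖ ≤ B^2 := by
      refine (ContinuousLinearMap.le_opNorm _ _).trans ?_
      simp only [EuclideanSpace.norm_single, norm_one, mul_one]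
      refine (ContinuousLinearMap.le_opNorm _ _).trans ?_
      have := (σ z).le_opNorm (EuclideanSpace.single i (1:ℝ))
      simp only [EuclideanSpace.norm_single, norm_one, mul_one] at this
      rw [pow_two]
      exact mul_le_mul (k1 z) (this.trans (k0 z)) (norm_nonneg _) hB
    gcongr
  refine (norm_sum_le_of_le _ fun i _ => norm_sum_le_of_le _ fun j _ => this i j).trans ?_
  simp
  apply le_of_eq; ring

lemma GG_lip {d m : ℕ} (σ : Vec d → Vec m →L[ℝ] Vec d) (hd : Differentiable ℝ σ) (B : ℝ)
    (hB : 0 ≤ B) (k0 : ∀ z, ‖σ z‖ ≤ B) (k1 : ∀ z, ‖fderiv ℝ σ z‖ ≤ B)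
    (k2 : ∀ z w, ‖σ z - σ w‖ ≤ B * ‖z - w‖)
    (k3 : ∀ z w, ‖fderiv ℝ σ z - fderiv ℝ σ w‖ ≤ B * ‖z - w‖)
    (z w : Vec d) (X : Mat m) :
    ‖GG d m σ z X - GG d m σ w X‖ ≤ 2 * ((m:ℝ)^2 * B^2) * ‖z - w‖ * ‖X‖ := by
  unfold GG
  simp only [← Finset.sum_sub_distrib, ← smul_sub]
  have : ∀ i j, ‖X (i,j) • (Dvf d m σ i j z - Dvf d m σ i j w)‖ ≤ ‖X‖ * (2 * B^2 * ‖z - w‖) := by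
    intro i j
    rw [norm_smul, Dvf_eq σ hd, Dvf_eq σ hd]
    have h1 := PiLp.norm_apply_le X (i,j)
    set e := (EuclideanSpace.single i (1:ℝ) : Vec m) with he
    have hen : ‖e‖ = 1 := by simp [he]
    have h2 : ‖fderiv ℝ σ z (σ z e) (EuclideanSpace.single j (1:ℝ)) -
        fderiv ℝ σ w (σ w e) (EuclideanSpace.single j (1:ℝ))‖ ≤ 2 * B^2 * ‖z - w‖ := by
      rw [← ContinuousLinearMap.sub_apply]
      refine (ContinuousLinearMap.le_opNorm _ _).trans ?_
      simp only [EuclideanSpace.norm_single, norm_one, mul_one]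
      have e1 : fderiv ℝ σ z (σ z e) - fderiv ℝ σ w (σ w e) =
        (fderiv ℝ σ z - fderiv ℝ σ w) (σ z e) + fderiv ℝ σ w ((σ z - σ w) e) := by
        simp
      rw [e1]
      refine (norm_add_le _ _).trans ?_
      have f1 : ‖σ z e‖ ≤ B := by
        have := (σ z).le_opNorm e; rw [hen, mul_one] at this; exact this.trans (k0 z)
      have f2 : ‖(σ z - σ w) e‖ ≤ B * ‖z - w‖ := by
        have := (σ z - σ w).le_opNorm e; rw [hen, mul_one] at this; exact this.trans (k2 z w)
      have g1 : ‖(fderiv ℝ σ z - fderiv ℝ σ w) (σ z e)‖ ≤ (B * ‖z - w‖) * B :=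
        (ContinuousLinearMap.le_opNorm _ _).trans
          (mul_le_mul (k3 z w) f1 (norm_nonneg _) (by positivity))
      have g2 : ‖fderiv ℝ σ w ((σ z - σ w) e)‖ ≤ B * (B * ‖z - w‖) :=
        (ContinuousLinearMap.le_opNorm _ _).trans
          (mul_le_mul (k1 w) f2 (norm_nonneg _) (by positivity))
      linarith
    gcongr
  refine (norm_sum_le_of_le _ fun i _ => norm_sum_le_of_le _ fun j _ => this i j).trans ?_
  simp
  apply le_of_eq; ring

lemma aux_holder {E : Type*} [NormedAddCommGroup E] {γ T M : ℝ} {x : ℝ → E} (hγ : 0 < γ)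
    (hx : holderENorm γ 0 T x < ⊤) (hM : holderInftyNorm γ 0 T x ≤ M) :
    ∀ s t, 0 ≤ s → s < t → t ≤ T → ‖x t - x s‖ ≤ M * (t - s) ^ γ := by
  have key : ∀ s t, 0 ≤ s → s < t → t ≤ T →
      ‖x t - x s‖ ≤ (holderENorm γ 0 T x).toReal * (t - s) ^ γ := by
    intro s t hs hst ht
    have hp : 0 < (t - s) ^ γ := Real.rpow_pos_of_pos (by linarith) _
    rw [← div_le_iff₀ hp, ← ENNReal.ofReal_le_iff_le_toReal hx.ne]
    exact le_iSup (fun p : {p : ℝ × ℝ // 0 ≤ p.1 ∧ p.1 < p.2 ∧ p.2 ≤ T} =>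
      ENNReal.ofReal (‖x p.1.2 - x p.1.1‖ / (p.1.2 - p.1.1) ^ γ)) ⟨(s,t), hs, hst, ht⟩
  have hsup : supENorm 0 T x < ⊤ := by
    refine lt_of_le_of_lt (b := ENNReal.ofReal (‖x 0‖ + (holderENorm γ 0 T x).toReal * T ^ γ))
      (iSup_le fun t => ENNReal.ofReal_le_ofReal ?_) ENNReal.ofReal_lt_top
    obtain ⟨t, ht0, htT⟩ := t
    have hT : 0 ≤ T := ht0.trans htT
    rcases ht0.eq_or_lt with h | h
    · subst h
      have : 0 ≤ (holderENorm γ 0 T x).toReal * T ^ γ := by positivity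
      simpa using this
    · have h1 := key 0 t le_rfl h htT
      have h2 : (t - 0) ^ γ ≤ T ^ γ := by rw [sub_zero]; gcongr
      have h3 : ‖x t‖ ≤ ‖x 0‖ + ‖x t - x 0‖ := by
        have := norm_add_le (x 0) (x t - x 0); simpa using this
      have h4 : (holderENorm γ 0 T x).toReal * (t - 0) ^ γ ≤
        (holderENorm γ 0 T x).toReal * T ^ γ := by gcongr
      show ‖x t‖ ≤ _
      linarith
  intro s t hs hst ht
  refine (key s t hs hst ht).trans ?_
  have hp : 0 < (t - s) ^ γ := Real.rpow_pos_of_pos (by linarith) _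
  gcongr
  refine le_trans ?_ hM
  unfold holderInftyNorm
  exact ENNReal.toReal_mono (by simp [hsup.ne, hx.ne]) le_add_self

lemma aux_holder2 {E : Type*} [NormedAddCommGroup E] {β T M : ℝ} {X : ℝ → ℝ → E}
    (hx : holder2ENorm β 0 T X < ⊤) (hM : (holder2ENorm β 0 T X).toReal ≤ M) :
    ∀ s t, 0 ≤ s → s < t → t ≤ T → ‖X s t‖ ≤ M * (t - s) ^ β := by
  intro s t hs hst ht
  have hp : 0 < (t - s) ^ β := Real.rpow_pos_of_pos (by linarith) _
  rw [← div_le_iff₀ hp]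
  refine le_trans ?_ hM
  rw [← ENNReal.ofReal_le_iff_le_toReal hx.ne]
  exact le_iSup (fun p : {p : ℝ × ℝ // 0 ≤ p.1 ∧ p.1 < p.2 ∧ p.2 ≤ T} =>
      ENNReal.ofReal (‖X p.1.1 p.1.2‖ / (p.1.2 - p.1.1) ^ β)) ⟨(s,t), hs, hst, ht⟩

/-- one-step estimate -/
lemma aux_step {d m : ℕ} (σ : Vec d → Vec m →L[ℝ] Vec d) (hd : Differentiable ℝ σ) (B A N : ℝ)
    (hB : 0 ≤ B) (hA : 0 ≤ A) (hN : N = (m:ℝ)^2 * B^2)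
    (k0 : ∀ z, ‖σ z‖ ≤ B) (k1 : ∀ z, ‖fderiv ℝ σ z‖ ≤ B)
    (k2 : ∀ z w, ‖σ z - σ w‖ ≤ B * ‖z - w‖)
    (k3 : ∀ z w, ‖fderiv ℝ σ z - fderiv ℝ σ w‖ ≤ B * ‖z - w‖)
    (k4 : ∀ z b, ‖σ (z + b) - σ z - fderiv ℝ σ z b‖ ≤ B * ‖b‖ ^ 2)
    (ys yu yt : Vec d) (xs xu xt : Vec m) (Xst Xsu Xut : Mat m) (η : ℝ) (hη0 : 0 ≤ η)
    (hη1 : η ≤ 1) (ha : ‖xu - xs‖ ≤ A * η) (hb : ‖xt - xu‖ ≤ A * η)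
    (hsu : ‖Xsu‖ ≤ A * η ^ 2) (hut : ‖Xut‖ ≤ A * η ^ 2)
    (chen : ∀ i j, Xst (i,j) - Xsu (i,j) - Xut (i,j) = (xu - xs) i * (xt - xu) j) :
    ‖yt - ys - σ ys (xt - xs) - GG d m σ ys Xst‖ ≤
      ‖yu - ys - σ ys (xu - xs) - GG d m σ ys Xsu‖
      + ‖yt - yu - σ yu (xt - xu) - GG d m σ yu Xut‖
      + (B * (B + N)^2 * A^3 + B * N * A^2 + 2 * N * (B + N) * A^2) * η^3
      + (B * A + 2 * N * A) * η * ‖yu - ys - σ ys (xu - xs) - GG d m σ ys Xsu‖ := by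
  have hN0 : 0 ≤ N := by rw [hN]; positivity
  have hG : ∀ z (X : Mat m), ‖GG d m σ z X‖ ≤ N * ‖X‖ := by
    intro z X; rw [hN]; exact GG_bound σ hd B hB k0 k1 z X
  have hGl : ∀ z w (X : Mat m), ‖GG d m σ z X - GG d m σ w X‖ ≤ 2 * N * ‖z - w‖ * ‖X‖ := by
    intro z w X; rw [hN]; exact GG_lip σ hd B hB k0 k1 k2 k3 z w X
  have hch := GG_chen σ hd ys Xst Xsu Xut _ _ chen
  set Rsu := yu - ys - σ ys (xu - xs) - GG d m σ ys Xsu with hRsu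
  set Rut := yt - yu - σ yu (xt - xu) - GG d m σ yu Xut with hRut
  set a := xu - xs with hadef
  set b := xt - xu with hbdef
  set p := σ ys a + GG d m σ ys Xsu with hp
  have hyu : yu = ys + p + Rsu := by rw [hRsu, hp]; abel
  have hxx : xt - xs = a + b := by rw [hadef, hbdef]; abel
  set Q := (σ yu - σ (ys + p)) + (σ (ys + p) - σ ys - fderiv ℝ σ ys p)
      + fderiv ℝ σ ys (GG d m σ ys Xsu) with hQ
  have hQ' : Q = σ yu - σ ys - fderiv ℝ σ ys (σ ys a) := by
    rw [hQ, hp, map_add]; abel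
  have hid : yt - ys - σ ys (xt - xs) - GG d m σ ys Xst =
      Rsu + Rut + (Q b + (GG d m σ yu Xut - GG d m σ ys Xut)) := by
    have : GG d m σ ys Xst = fderiv ℝ σ ys (σ ys a) b + GG d m σ ys Xut + GG d m σ ys Xsu := by
      rw [← hch]; abel
    rw [this, hQ', hRsu, hRut, hxx, map_add]
    simp only [ContinuousLinearMap.sub_apply]
    abel
  have hpn : ‖p‖ ≤ (B + N) * A * η := by
    have h1 : ‖σ ys a‖ ≤ B * (A * η) := ((σ ys).le_opNorm a).trans
      (mul_le_mul (k0 ys) ha (norm_nonneg _) hB)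
    have h2 : ‖GG d m σ ys Xsu‖ ≤ N * (A * η ^ 2) := (hG _ _).trans (by gcongr)
    have h3 : N * (A * η ^ 2) ≤ N * (A * η) := by gcongr; nlinarith
    have := norm_add_le (σ ys a) (GG d m σ ys Xsu)
    rw [hp]; linarith
  have q1 : ‖σ yu - σ (ys + p)‖ ≤ B * ‖Rsu‖ := by
    refine (k2 _ _).trans (le_of_eq ?_)
    congr 2; rw [hyu]; abel
  have q2 : ‖σ (ys + p) - σ ys - fderiv ℝ σ ys p‖ ≤ B * ((B + N) * A * η)^2 :=
    (k4 _ _).trans (by gcongr)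
  have q3 : ‖fderiv ℝ σ ys (GG d m σ ys Xsu)‖ ≤ B * (N * (A * η^2)) :=
    (ContinuousLinearMap.le_opNorm _ _).trans
      (mul_le_mul (k1 _) ((hG _ _).trans (by gcongr)) (norm_nonneg _) hB)
  have qQ : ‖Q‖ ≤ B * ‖Rsu‖ + B * ((B + N) * A * η)^2 + B * (N * (A * η^2)) :=
    (norm_add₃_le).trans (by linarith)
  have qb : ‖Q b‖ ≤ (B * ‖Rsu‖ + B * ((B + N) * A * η)^2 + B * (N * (A * η^2))) * (A * η) :=
    (ContinuousLinearMap.le_opNorm _ _).trans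
      (mul_le_mul qQ hb (norm_nonneg _) (by positivity))
  have hyn : ‖yu - ys‖ ≤ (B + N) * A * η + ‖Rsu‖ := by
    have : yu - ys = p + Rsu := by rw [hyu]; abel
    rw [this]; exact (norm_add_le _ _).trans (by linarith)
  have qG : ‖GG d m σ yu Xut - GG d m σ ys Xut‖ ≤
      2 * N * ((B + N) * A * η + ‖Rsu‖) * (A * η^2) :=
    (hGl _ _ _).trans (by gcongr)
  have hη2 : 2 * N * ‖Rsu‖ * (A * η^2) ≤ 2 * N * ‖Rsu‖ * (A * η) := by gcongr; nlinarith
  rw [hid]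
  have t1 := norm_add_le (Rsu + Rut) (Q b + (GG d m σ yu Xut - GG d m σ ys Xut))
  have t2 := norm_add_le Rsu Rut
  have t3 := norm_add_le (Q b) (GG d m σ yu Xut - GG d m σ ys Xut)
  linarith

set_option maxHeartbeats 4000000 in
/-- **Modulus of continuity of the solution of a rough differential equation inherited from
the driver.** If the driver `x` of a γ-rough path satisfies
`|x_t - x_s| ≤ K (t-s)^H √(log(1/(t-s)))` for `0 < t-s ≤ h*`, then the solution `y` of
`dy = σ(y)dx` satisfies `|y_t - y_s| ≤ K' (t-s)^H √(log(1/(t-s)))` for `0 < t-s ≤ h**`, where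
`h** ∈ (0,h*]` and `K'` depend only on `H, γ, κ, σ, T, K` and (bounds for) `‖x‖_{γ,∞,T}`,
`‖X²‖_{2γ}`. -/
theorem rde_solution_modulus (d m : ℕ) (H γ κ T : ℝ)
    (hγ : 1 / 3 < γ) (hγH : γ < H) (hH : H ≤ 1) (hH2γ : H < 2 * γ) (hT : 0 < T)
    (hκ1 : max (1 / 3) (H / 2) < κ) (hκ2 : κ < γ)
    (σ : Vec d → Vec m →L[ℝ] Vec d) (hσ : IsC3Bounded σ)
    (K hstar : ℝ) (hK : 0 ≤ K) (hhs1 : 0 < hstar) (hhs2 : hstar ≤ min T (Real.exp (-1)))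
    (Mx MX : ℝ) :
    ∃ hss K' : ℝ, 0 < hss ∧ hss ≤ hstar ∧ 0 ≤ K' ∧
      ∀ (x : ℝ → Vec m) (X2 : ℝ → ℝ → Mat m) (a : Vec d) (y : ℝ → Vec d),
        IsRoughPath m γ 0 T x X2 →
        holderInftyNorm γ 0 T x ≤ Mx →
        (holder2ENorm (2 * γ) 0 T X2).toReal ≤ MX →
        (∀ s t : ℝ, 0 ≤ s → s < t → t ≤ T → t - s ≤ hstar →
          ‖x t - x s‖ ≤ K * (t - s) ^ H * Real.sqrt (Real.log (1 / (t - s)))) →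
        IsRDESolution d m (3 * κ) T σ x X2 a y →
        ∀ s t : ℝ, 0 ≤ s → s < t → t ≤ T → t - s ≤ hss →
          ‖y t - y s‖ ≤ K' * (t - s) ^ H * Real.sqrt (Real.log (1 / (t - s))) := by
  have hκ : 1/3 < κ := (le_max_left _ _).trans_lt hκ1
  have hκH : H/2 < κ := (le_max_right _ _).trans_lt hκ1
  have hγ0 : 0 < γ := by linarith
  have hθ : 1 < 3 * κ := by linarith
  obtain ⟨B, hB, k0, k1, k2, k3, k4⟩ := aux_sigma σ hσ
  have hd : Differentiable ℝ σ := hσ.1.differentiable (by norm_num)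
  set N := (m:ℝ)^2 * B^2 with hN
  have hN0 : 0 ≤ N := by positivity
  set A := max (max Mx MX) 0 with hAdef
  have hA : 0 ≤ A := le_max_right _ _
  have hAx : Mx ≤ A := (le_max_left _ _).trans (le_max_left _ _)
  have hAX : MX ≤ A := (le_max_right _ _).trans (le_max_left _ _)
  set c := (B * (B + N)^2 * A^3 + B * N * A^2 + 2 * N * (B + N) * A^2) + (B * A + 2 * N * A)
    with hc
  have hc1 : 0 ≤ B * (B + N)^2 * A^3 + B * N * A^2 + 2 * N * (B + N) * A^2 := by positivity
  have hc2 : 0 ≤ B * A + 2 * N * A := by positivity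
  have hc0 : 0 ≤ c := by positivity
  set q := (1 - 2 * (1/2:ℝ) ^ (3 * κ)) / 2 with hq
  have hq0 : 0 < q := by
    have : (1/2:ℝ) ^ (3 * κ) < (1/2:ℝ) ^ (1:ℝ) :=
      Real.rpow_lt_rpow_of_exponent_gt (by norm_num) (by norm_num) hθ
    rw [Real.rpow_one] at this
    rw [hq]; linarith
  set r := (q / (c + 1)) ^ (1/γ) with hr
  have hr0 : 0 < r := by positivity
  have hrγ : r ^ γ = q / (c + 1) := by
    rw [hr, ← Real.rpow_mul (by positivity), one_div_mul_cancel hγ0.ne', Real.rpow_one]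
  set h := min hstar r with hh
  have hh0 : 0 < h := lt_min hhs1 hr0
  have hhs : h ≤ hstar := min_le_left _ _
  have hch : c * h ^ γ ≤ q := by
    calc c * h ^ γ ≤ c * r ^ γ := by gcongr; exact min_le_right _ _
      _ = c / (c + 1) * q := by rw [hrγ]; ring
      _ ≤ 1 * q := by
        gcongr
        rw [div_le_one (by linarith)]; linarith
      _ = q := one_mul q
  set L := 2 * c / (1 - 2 * (1/2:ℝ) ^ (3 * κ)) with hL
  have hL0 : 0 ≤ L := div_nonneg (by linarith) (by rw [hq] at hq0; linarith)
  refine ⟨h, B * K + N * A + L, hh0, hhs, by positivity, ?_⟩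
  intro x X2 a y hrp hMx hMX hmod hsol
  obtain ⟨hx, -, hX, chen⟩ := hrp
  obtain ⟨-, -, C, hC⟩ := hsol
  have hxb := aux_holder hγ0 hx (hMx.trans hAx)
  have hXb := aux_holder2 hX (hMX.trans hAX)
  have hT1 : h ≤ Real.exp (-1) := hhs.trans (hhs2.trans (min_le_right _ _))
  have he1 : Real.exp (-1) ≤ 1 := Real.exp_le_one_iff.mpr (by norm_num)
  have main := aux_iter T h (3 * κ) γ c |C|
    (fun s t => ‖y t - y s - σ (y s) (x t - x s) - GG d m σ (y s) (X2 s t)‖)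
    hθ hγ0 hc0 (abs_nonneg C) hch
    (by
      intro s t hs hst ht _
      refine (hC s t hs hst.le ht).trans ?_
      have : 0 < t - s := by linarith
      gcongr
      exact le_abs_self C)
    (by
      intro s t hs hst ht hth
      have hd0 : 0 < t - s := by linarith
      have hd1 : t - s ≤ 1 := by linarith
      have g1 : (s+t)/2 - s ≤ t - s := by linarith
      have g2 : t - (s+t)/2 ≤ t - s := by linarith
      have p1 : 0 ≤ (s+t)/2 - s := by linarith
      have p2 : 0 ≤ t - (s+t)/2 := by linarith
      have sq : ((t - s) ^ γ)^2 = (t-s)^(2*γ) := by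
        rw [← Real.rpow_natCast, ← Real.rpow_mul hd0.le]; congr 1; push_cast; ring
      have cu : ((t - s) ^ γ)^3 ≤ (t-s)^(3*κ) := by
        rw [← Real.rpow_natCast, ← Real.rpow_mul hd0.le]
        apply Real.rpow_le_rpow_of_exponent_ge hd0 hd1
        push_cast; linarith
      have hη0 : 0 ≤ (t-s)^γ := by positivity
      have st := aux_step σ hd B A N hB hA hN k0 k1 k2 k3 k4 (y s) (y ((s+t)/2)) (y t)
        (x s) (x ((s+t)/2)) (x t) (X2 s t) (X2 s ((s+t)/2)) (X2 ((s+t)/2) t) ((t-s)^γ)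
        hη0 (Real.rpow_le_one hd0.le hd1 hγ0.le)
        ((hxb s ((s+t)/2) hs (by linarith) (by linarith)).trans (by gcongr))
        ((hxb ((s+t)/2) t (by linarith) (by linarith) ht).trans (by gcongr))
        ((hXb s ((s+t)/2) hs (by linarith) (by linarith)).trans (by rw [sq]; gcongr))
        ((hXb ((s+t)/2) t (by linarith) (by linarith) ht).trans (by rw [sq]; gcongr))
        (fun i j => chen s ((s+t)/2) t hs (by linarith) (by linarith) ht i j)
      refine st.trans ?_
      have n1 : (B * (B + N)^2 * A^3 + B * N * A^2 + 2 * N * (B + N) * A^2) * ((t-s)^γ)^3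
          ≤ c * (t-s)^(3*κ) := by
        apply mul_le_mul _ cu (by positivity) hc0
        rw [hc]; linarith
      have n2 : (B * A + 2 * N * A) ≤ c := by rw [hc]; linarith
      gcongr)
  intro s t hs hst ht hth
  have hd0 : 0 < t - s := by linarith
  have hd1 : t - s ≤ 1 := by linarith
  have hR := main s t hs hst ht hth
  have hlog : 1 ≤ Real.sqrt (Real.log (1 / (t - s))) := by
    rw [Real.one_le_sqrt, one_div, Real.log_inv]
    have := Real.log_le_log hd0 (hth.trans hT1)
    rw [Real.log_exp] at this
    linarith
  set S := Real.sqrt (Real.log (1 / (t - s))) with hS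
  have hxm := hmod s t hs hst ht (hth.trans hhs)
  have e1 : ‖σ (y s) (x t - x s)‖ ≤ B * (K * (t - s) ^ H * S) :=
    ((σ (y s)).le_opNorm _).trans (mul_le_mul (k0 _) hxm (norm_nonneg _) hB)
  have hHp : 0 < (t-s)^H := by positivity
  have hHS : (t-s)^H ≤ (t-s)^H * S := le_mul_of_one_le_right hHp.le hlog
  have e2 : ‖GG d m σ (y s) (X2 s t)‖ ≤ N * (A * ((t-s)^H * S)) := by
    refine (GG_bound σ hd B hB k0 k1 _ _).trans ?_
    rw [← hN]
    gcongr
    refine (hXb s t hs hst ht).trans ?_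
    gcongr
    refine le_trans ?_ hHS
    exact Real.rpow_le_rpow_of_exponent_ge hd0 hd1 hH2γ.le
  have e3 : L * (t-s)^(3*κ) ≤ L * ((t-s)^H * S) := by
    gcongr
    refine le_trans ?_ hHS
    exact Real.rpow_le_rpow_of_exponent_ge hd0 hd1 (by linarith)
  have e4 : y t - y s = (y t - y s - σ (y s) (x t - x s) - GG d m σ (y s) (X2 s t))
      + σ (y s) (x t - x s) + GG d m σ (y s) (X2 s t) := by abel
  rw [e4]
  refine (norm_add₃_le).trans ?_
  linarith

end
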